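/- Fix q₀ ∈ ℝ with 0 < q₀ < 1, z ∈ ℂ∖{0}, λ_0, …, λ_N ∈ ℂ and i ∈ {0,…,N}. For t ∈ (0,1] set q = q₀^t and, for w ∈ ℂ, q^w := exp(w·t·ln q₀). Assume: (a) λ_i − λ_j + rz ≠ 0 for all j and all integers r ≥ 1; (b) 1 − q^{r + (λ_i−λ_j)/z} ≠ 0 for all t ∈ (0,1], all j and all r ≥ 1; (c) Q ∈ ℂ∖ℝ_{≤0} and θ_{q₀^t}(Q) ≠ 0 for all t ∈ (0,1]. Then for all sufficiently small t > 0 the series F(t) = exp( (λ_i/z)·t·ln(q₀)·ℓ_{q₀^t}(Q) ) · Σ_{d≥0} Q^d (1−q₀^t)^{d(N+1)} z^{−d(N+1)} ∏_{j=0}^N ∏_{r=1}^d (1 − (q₀^t)^{r + (λ_i−λ_j)/z})^{−1} converges absolutely, and lim_{t→0⁺} F(t) = exp((λ_i/z)·log Q) · Σ_{d≥0} Q^d ∏_{r=1}^d ∏_{j=0}^N (λ_i − λ_j + rz)^{−1}, where log is the principal branch of the logarithm and the limit series is entire in Q. (This is the i-th component of the statement that, after the pullback Q ↦ (z/(1−q))^{N+1}Q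 and a q-constant change of fundamental solution, Givental's small equivariant K-theoretical J-function of ℙ^N confluences to the small equivariant cohomological J-function.) -/

import Mathlib

open Complex Filter Topology

/-- Jacobi's theta function `θ_q(Q) = Σ_{d ∈ ℤ} q^{d(d-1)/2} Q^d`. -/
noncomputable def theta (q Q : ℂ) : ℂ :=
  ∑' d : ℤ, q ^ (d * (d - 1) / 2).toNat * Q ^ d

/-- The q-logarithm `ℓ_q(Q) = -Q·θ_q′(Q)/θ_q(Q)`. -/
noncomputable def ellq (q Q : ℂ) : ℂ :=
  -Q * deriv (theta q) Q / theta q Q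

lemma tendsto_tsum_prod_Icc {α : Type*} {l : Filter α} [l.NeBot] {g : α → ℕ → ℂ} {h : ℕ → ℂ}
    (hg : ∀ r, 1 ≤ r → Tendsto (fun s => g s r) l (𝓝 (h r))) {R : ℕ}
    (hR : ∀ᶠ s in l, ∀ r, R ≤ r → ‖g s r‖ ≤ 1 / 2) :
    (∀ᶠ s in l, Summable fun d : ℕ => ‖∏ r ∈ Finset.Icc 1 d, g s r‖) ∧
    (Summable fun d : ℕ => ‖∏ r ∈ Finset.Icc 1 d, h r‖) ∧
    Tendsto (fun s => ∑' d : ℕ, ∏ r ∈ Finset.Icc 1 d, g s r) l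
      (𝓝 (∑' d : ℕ, ∏ r ∈ Finset.Icc 1 d, h r)) := by
  set b : ℕ → ℝ := fun r => if r < R then ‖h r‖ + 1 else 1 / 2 with hb
  have hb0 : ∀ r, 0 ≤ b r := fun r => by simp only [hb]; split_ifs <;> positivity
  have hgb : ∀ᶠ s in l, ∀ r, 1 ≤ r → ‖g s r‖ ≤ b r := by
    have h1 : ∀ᶠ s in l, ∀ r ∈ Finset.Ico 1 R, ‖g s r‖ ≤ ‖h r‖ + 1 := by
      rw [Filter.eventually_all_finset]
      intro r hr
      exact (hg r (Finset.mem_Ico.mp hr).1).norm.eventually_le_const (lt_add_one _)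
    filter_upwards [h1, hR] with s hs1 hs2 r hr
    simp only [hb]
    split_ifs with hrR
    · exact hs1 r (Finset.mem_Ico.mpr ⟨hr, hrR⟩)
    · exact hs2 r (not_lt.mp hrR)
  have hhb : ∀ r, 1 ≤ r → ‖h r‖ ≤ b r := fun r hr =>
    le_of_tendsto (hg r hr).norm (hgb.mono fun s hs => hs r hr)
  have hbsum : Summable fun d : ℕ => ∏ r ∈ Finset.Icc 1 d, b r := by
    refine summable_of_ratio_norm_eventually_le (r := 1 / 2) (by norm_num) ?_
    filter_upwards [eventually_ge_atTop R] with d hd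
    rw [Finset.prod_Icc_succ_top (by omega), norm_mul, mul_comm]
    gcongr
    have : b (d + 1) = 1 / 2 := by simp only [hb]; rw [if_neg (by omega)]
    rw [this]; norm_num
  have hprod : ∀ f : ℕ → ℂ, (∀ r, 1 ≤ r → ‖f r‖ ≤ b r) → ∀ d : ℕ,
      ‖∏ r ∈ Finset.Icc 1 d, f r‖ ≤ ∏ r ∈ Finset.Icc 1 d, b r := by
    intro f hf d
    rw [norm_prod]
    exact Finset.prod_le_prod (fun _ _ => norm_nonneg _)
      fun r hr => hf r (Finset.mem_Icc.mp hr).1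
  refine ⟨?_, ?_, ?_⟩
  · filter_upwards [hgb] with s hs
    exact hbsum.of_nonneg_of_le (fun _ => norm_nonneg _) (hprod _ hs)
  · exact hbsum.of_nonneg_of_le (fun _ => norm_nonneg _) (hprod _ hhb)
  · refine tendsto_tsum_of_dominated_convergence hbsum (fun d => ?_)
      (hgb.mono fun s hs => hprod _ hs)
    exact tendsto_finsetProd _ fun r hr => hg r (Finset.mem_Icc.mp hr).1

lemma tendsto_one_sub_exp_div (c : ℂ) :
    Tendsto (fun s : ℝ => (1 - cexp (-(s * c))) / s) (𝓝[>] 0) (𝓝 c) := by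
  have h : HasDerivAt (fun s : ℝ => 1 - cexp (-(s * c))) c 0 := by
    have h1 : HasDerivAt (fun s : ℝ => -((s : ℂ) * c)) (-(1 * c)) 0 :=
      ((Complex.ofRealCLM.hasDerivAt (x := (0 : ℝ))).mul_const c).neg
    simpa using (h1.cexp).const_sub 1
  have h2 := h.tendsto_slope_zero_right
  refine h2.congr fun s => ?_
  simp [div_eq_inv_mul]

lemma tendsto_one_sub_exp_div_one_sub_exp {c : ℂ} (hc : c ≠ 0) :
    Tendsto (fun s : ℝ => (1 - cexp (-s)) * (1 - cexp (-(s * c)))⁻¹) (𝓝[>] 0) (𝓝 c⁻¹) := by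
  have h := (tendsto_one_sub_exp_div 1).mul ((tendsto_one_sub_exp_div c).inv₀ hc)
  rw [one_mul] at h
  refine h.congr' ?_
  filter_upwards [self_mem_nhdsWithin] with s hs
  have : (s : ℂ) ≠ 0 := by exact_mod_cast (ne_of_gt hs)
  rw [mul_one, inv_div]
  field_simp

lemma eventually_norm_one_sub_exp_ratio_le {M : ℝ} (hM : 0 < M) :
    ∀ᶠ s : ℝ in 𝓝[>] 0, ∀ c : ℂ, M ≤ c.re →
      ‖(1 - cexp (-s)) * (1 - cexp (-(s * c)))⁻¹‖ ≤ 2 / M := by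
  have hM' : (M : ℂ) ≠ 0 := by exact_mod_cast hM.ne'
  have h := (tendsto_one_sub_exp_div_one_sub_exp hM').norm.eventually_le_const
    (show ‖(M : ℂ)⁻¹‖ < 2 / M by
      rw [norm_inv, Complex.norm_real, Real.norm_of_nonneg hM.le, ← one_div]
      gcongr; norm_num)
  filter_upwards [h, self_mem_nhdsWithin] with s hs hs0 c hc
  have hs0 : 0 < s := hs0
  refine le_trans ?_ hs
  rw [norm_mul, norm_mul, norm_inv, norm_inv]
  have hlt : Real.exp (-(s * M)) < 1 := by
    rw [Real.exp_lt_one_iff]; nlinarith [mul_pos hs0 hM]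
  have e1 : ‖1 - cexp (-(s * (M : ℂ)))‖ = 1 - Real.exp (-(s * M)) := by
    have : 1 - cexp (-(s * (M : ℂ))) = ((1 - Real.exp (-(s * M)) : ℝ) : ℂ) := by push_cast; rfl
    rw [this, Complex.norm_real, Real.norm_of_nonneg (by linarith)]
  have e2 : 1 - Real.exp (-(s * M)) ≤ ‖1 - cexp (-(s * c))‖ := by
    have h1 := norm_sub_norm_le 1 (cexp (-(s * c)))
    rw [norm_one, Complex.norm_exp] at h1
    have h2 : (-(s * c)).re = -(s * c.re) := by simp
    rw [h2] at h1
    have h3 : Real.exp (-(s * c.re)) ≤ Real.exp (-(s * M)) := by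
      gcongr
    linarith
  rw [e1]
  gcongr

lemma theta_exp_eq_jacobiTheta₂ (s : ℝ) (v : ℂ) :
    theta (cexp (-s)) (cexp v) =
      jacobiTheta₂ ((v + s / 2) / (2 * Real.pi * I)) (I * s / (2 * Real.pi)) := by
  have hpi : (Real.pi : ℂ) ≠ 0 := by exact_mod_cast Real.pi_ne_zero
  refine tsum_congr fun d => ?_
  have h0 : 0 ≤ d * (d - 1) / 2 := by
    refine Int.ediv_nonneg ?_ (by norm_num)
    rcases le_or_gt d 0 with h | h
    · exact mul_nonneg_of_nonpos_of_nonpos h (by omega)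
    · exact mul_nonneg h.le (by omega)
  have h1 : (((d * (d - 1) / 2).toNat : ℕ) : ℂ) = d * (d - 1) / 2 := by
    have h2 : (((d * (d - 1) / 2).toNat : ℕ) : ℂ) = ((d * (d - 1) / 2 : ℤ) : ℂ) := by
      exact_mod_cast congrArg (Int.cast (R := ℂ)) (Int.toNat_of_nonneg h0)
    rw [h2, Int.cast_div (by simpa using (Int.even_mul_pred_self d).two_dvd) (by norm_num)]
    push_cast; ring
  rw [← Complex.exp_nat_mul, ← Complex.exp_int_mul, ← Complex.exp_add, h1, jacobiTheta₂_term]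
  congr 1
  field_simp
  linear_combination (-(s : ℂ) * d ^ 2) * I_sq

lemma tendsto_tsum_mul_jacobiTheta₂_term {u : ℂ} (hu : |u.im| < Real.pi) {f : ℤ → ℂ} {C : ℝ}
    (hf : ∀ n : ℤ, ‖f n‖ ≤ C * |(n : ℝ)| + C) :
    Tendsto (fun s : ℝ => ∑' n : ℤ, f n *
      jacobiTheta₂_term n (-(u + s / 2) / s) (2 * Real.pi * I / s)) (𝓝[>] 0) (𝓝 (f 0)) := by
  have hpi := Real.pi_pos
  set δ : ℝ := Real.pi - |u.im| with hδ
  have hδ0 : 0 < δ := sub_pos.mpr hu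
  have hterm : ∀ s : ℝ, 0 < s → ∀ n : ℤ,
      ‖jacobiTheta₂_term n (-(u + s / 2) / s) (2 * Real.pi * I / s)‖ ≤
        Real.exp (-(2 * Real.pi * δ * (n : ℝ) ^ 2 * s⁻¹)) := by
    intro s hs n
    rw [norm_jacobiTheta₂_term]
    have e1 : (-(u + s / 2) / (s : ℂ)).im = -u.im / s := by
      rw [Complex.div_ofReal_im]; simp
    have e2 : (2 * Real.pi * I / (s : ℂ)).im = 2 * Real.pi / s := by
      rw [Complex.div_ofReal_im]; simp
    rw [e1, e2, Real.exp_le_exp]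
    have hn : (n : ℝ) * u.im ≤ (n : ℝ) ^ 2 * |u.im| := by
      have h1 : (n : ℝ) * u.im ≤ |(n : ℝ)| * |u.im| := by
        rw [← abs_mul]; exact le_abs_self _
      have h2 : |(n : ℝ)| ≤ (n : ℝ) ^ 2 := by
        have : |n| ≤ n ^ 2 := by
          rcases eq_or_ne n 0 with rfl | hn
          · simp
          · nlinarith [Int.one_le_abs hn, sq_abs n]
        exact_mod_cast this
      exact h1.trans (by gcongr)
    have hsi : 0 < s⁻¹ := inv_pos.mpr hs
    have : 0 ≤ 2 * Real.pi * s⁻¹ * ((n : ℝ) ^ 2 * |u.im| - n * u.im) :=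
      mul_nonneg (by positivity) (by linarith)
    rw [hδ, div_eq_mul_inv, div_eq_mul_inv]
    nlinarith
  have hsum : Summable fun n : ℤ =>
      (C * |(n : ℝ)| + C) * Real.exp (-(2 * Real.pi * δ * (n : ℝ) ^ 2)) := by
    have hT : 0 < 2 * δ := by positivity
    have h1 := (summable_pow_mul_jacobiTheta₂_term_bound 0 hT 1).mul_left C
    have h0 := (summable_pow_mul_jacobiTheta₂_term_bound 0 hT 0).mul_left C
    refine (h1.add h0).congr fun n => ?_
    have : -Real.pi * (2 * δ * (n : ℝ) ^ 2 - 2 * 0 * |(n : ℝ)|) =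
        -(2 * Real.pi * δ * (n : ℝ) ^ 2) := by ring
    push_cast
    rw [this]; ring
  have hlim : ∀ n : ℤ, Tendsto (fun s : ℝ => f n *
      jacobiTheta₂_term n (-(u + s / 2) / s) (2 * Real.pi * I / s)) (𝓝[>] 0)
      (𝓝 (if n = 0 then f 0 else 0)) := by
    intro n
    split_ifs with hn
    · subst hn
      simp [jacobiTheta₂_term]
    · rw [← mul_zero (f n)]
      refine Tendsto.const_mul _ (squeeze_zero_norm' (a := fun s : ℝ =>
        Real.exp (-(2 * Real.pi * δ * (n : ℝ) ^ 2 * s⁻¹))) ?_ ?_)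
      · filter_upwards [self_mem_nhdsWithin] with s hs using hterm s hs n
      · have hn' : (n : ℝ) ≠ 0 := by exact_mod_cast hn
        exact Real.tendsto_exp_neg_atTop_nhds_zero.comp
          (tendsto_inv_nhdsGT_zero.const_mul_atTop (by positivity))
  have key := tendsto_tsum_of_dominated_convergence hsum hlim (by
    filter_upwards [Ioo_mem_nhdsGT (zero_lt_one' ℝ)] with s hs n
    rw [norm_mul]
    refine mul_le_mul (hf n) ((hterm s hs.1 n).trans ?_) (norm_nonneg _)
      ((norm_nonneg _).trans (hf n))
    rw [Real.exp_le_exp, neg_le_neg_iff]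
    exact le_mul_of_one_le_right (by positivity) ((one_le_inv₀ hs.1).mpr hs.2.le))
  rwa [tsum_ite_eq] at key

lemma neg_mul_ellq_exp {Q : ℂ} (hQ : Q ∈ slitPlane) {s : ℝ} (hs : 0 < s)
    (hJ : jacobiTheta₂ (-(log Q + s / 2) / s) (2 * Real.pi * I / s) ≠ 0) :
    -s * ellq (cexp (-s)) Q = log Q + s / 2 -
      jacobiTheta₂' (-(log Q + s / 2) / s) (2 * Real.pi * I / s) /
        jacobiTheta₂ (-(log Q + s / 2) / s) (2 * Real.pi * I / s) := by
  have hpi : (Real.pi : ℂ) ≠ 0 := by exact_mod_cast Real.pi_ne_zero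
  have hs' : (s : ℂ) ≠ 0 := by exact_mod_cast hs.ne'
  have hQ0 : Q ≠ 0 := slitPlane_ne_zero hQ
  set τ : ℂ := I * s / (2 * Real.pi) with hτ
  set ζ : ℂ := (log Q + s / 2) / (2 * Real.pi * I) with hζ
  have hτim : 0 < τ.im := by
    have : τ = ((s / (2 * Real.pi) : ℝ) : ℂ) * I := by rw [hτ]; push_cast; ring
    rw [this, Complex.im_ofReal_mul, I_im, mul_one]
    positivity
  have hτ0 : τ ≠ 0 := by rw [hτ]; simp [hs', hpi]
  have ew : -(log Q + s / 2) / s = ζ / τ := by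
    rw [hζ, hτ]; field_simp; rw [I_sq]; ring
  have eτ : 2 * Real.pi * I / s = -1 / τ := by
    rw [hτ]; field_simp; rw [I_sq]
  have hval : theta (cexp (-s)) Q = jacobiTheta₂ ζ τ := by
    rw [hζ, hτ, ← theta_exp_eq_jacobiTheta₂, exp_log hQ0]
  have hev : theta (cexp (-s)) =ᶠ[𝓝 Q]
      fun x => jacobiTheta₂ ((log x + s / 2) / (2 * Real.pi * I)) τ := by
    filter_upwards [isOpen_slitPlane.mem_nhds hQ] with x hx
    rw [hτ, ← theta_exp_eq_jacobiTheta₂, exp_log (slitPlane_ne_zero hx)]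
  have hder : deriv (theta (cexp (-s))) Q =
      jacobiTheta₂' ζ τ * (Q⁻¹ / (2 * Real.pi * I)) := by
    rw [hev.deriv_eq]
    exact ((hasDerivAt_jacobiTheta₂_fst ζ hτim).comp Q
      (((hasDerivAt_log hQ).add_const _).div_const _)).deriv
  rw [ew, eτ] at hJ ⊢
  rw [ellq, hder, hval, jacobiTheta₂_functional_equation ζ τ,
    jacobiTheta₂'_functional_equation ζ τ]
  have hA : 1 / (-I * τ) ^ (1 / 2 : ℂ) * cexp (-Real.pi * I * ζ ^ 2 / τ) ≠ 0 := by
    refine mul_ne_zero (one_div_ne_zero ?_) (exp_ne_zero _)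
    rw [Ne, cpow_eq_zero_iff]
    simp [hτ0]
  set A : ℂ := 1 / (-I * τ) ^ (1 / 2 : ℂ) * cexp (-Real.pi * I * ζ ^ 2 / τ)
  set J := jacobiTheta₂ (ζ / τ) (-1 / τ)
  set J' := jacobiTheta₂' (ζ / τ) (-1 / τ)
  have e1 : log Q + s / 2 = 2 * Real.pi * I * ζ := by
    rw [hζ]; field_simp
  have e2 : (s : ℂ) = -(2 * Real.pi * I * τ) := by
    rw [hτ]; field_simp; rw [I_sq]; ring
  rw [e1, e2]
  field_simp
  ring

lemma tendsto_neg_mul_ellq_exp {Q : ℂ} (hQ : Q ∈ slitPlane) :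
    Tendsto (fun s : ℝ => -s * ellq (cexp (-s)) Q) (𝓝[>] 0) (𝓝 (log Q)) := by
  have hu : |(log Q).im| < Real.pi := by
    rw [log_im, abs_lt]
    exact ⟨neg_pi_lt_arg Q, lt_of_le_of_ne (arg_le_pi Q) (mem_slitPlane_iff_arg.mp hQ).1⟩
  have hJ : Tendsto (fun s : ℝ => jacobiTheta₂ (-(log Q + s / 2) / s) (2 * Real.pi * I / s))
      (𝓝[>] 0) (𝓝 1) := by
    have h := tendsto_tsum_mul_jacobiTheta₂_term hu (f := fun _ => 1) (C := 1)
      (fun n => by simp)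
    simpa only [one_mul, jacobiTheta₂] using h
  have hJ' : Tendsto (fun s : ℝ => jacobiTheta₂' (-(log Q + s / 2) / s) (2 * Real.pi * I / s))
      (𝓝[>] 0) (𝓝 0) := by
    have h := tendsto_tsum_mul_jacobiTheta₂_term hu (f := fun n => 2 * Real.pi * I * n)
      (C := 2 * Real.pi) (fun n => by
        have := Real.pi_pos
        simp [abs_of_pos this, this.le])
    simpa only [Int.cast_zero, mul_zero, jacobiTheta₂', jacobiTheta₂'_term] using h
  have hs : Tendsto (fun s : ℝ => log Q + (s : ℂ) / 2) (𝓝[>] 0) (𝓝 (log Q)) := by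
    have : Continuous fun s : ℝ => log Q + (s : ℂ) / 2 := by fun_prop
    simpa using (this.tendsto 0).mono_left nhdsWithin_le_nhds
  have h := hs.sub (hJ'.div hJ one_ne_zero)
  rw [zero_div, sub_zero] at h
  refine h.congr' ?_
  filter_upwards [self_mem_nhdsWithin, hJ.eventually_ne one_ne_zero] with s hs hJs
  exact (neg_mul_ellq_exp hQ hs hJs).symm

lemma tendsto_factor {N : ℕ} (z Q : ℂ) (a : Fin (N + 1) → ℂ) (r : ℕ)
    (ha : ∀ j, (r : ℂ) + a j ≠ 0) :
    Tendsto (fun s : ℝ => Q * ∏ j, ((1 - cexp (-s)) * (1 - cexp (-(s * (r + a j))))⁻¹ * z⁻¹))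
      (𝓝[>] 0) (𝓝 (Q * ∏ j, (a j * z + r * z)⁻¹)) := by
  refine Tendsto.const_mul _ (tendsto_finsetProd _ fun j _ => ?_)
  rw [show (a j * z + r * z)⁻¹ = ((r : ℂ) + a j)⁻¹ * z⁻¹ by rw [← mul_inv]; ring_nf]
  exact (tendsto_one_sub_exp_div_one_sub_exp (ha j)).mul_const _

lemma eventually_norm_factor_le {N : ℕ} {z : ℂ} (hz : z ≠ 0) (Q : ℂ) (a : Fin (N + 1) → ℂ) :
    ∃ R : ℕ, ∀ᶠ s : ℝ in 𝓝[>] 0, ∀ r : ℕ, R ≤ r →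
      ‖Q * ∏ j, ((1 - cexp (-s)) * (1 - cexp (-(s * (r + a j))))⁻¹ * z⁻¹)‖ ≤ 1 / 2 := by
  have hz0 : 0 < ‖z‖ := norm_pos_iff.mpr hz
  set ε : ℝ := 1 / (2 * (‖Q‖ + 1)) with hε
  have hε0 : 0 < ε := by positivity
  have hε1 : ε ≤ 1 := by
    rw [hε, div_le_one (by positivity)]
    linarith [norm_nonneg Q]
  set M : ℝ := 2 / (ε * ‖z‖) with hM
  have hM0 : 0 < M := by positivity
  obtain ⟨R, hR⟩ := exists_nat_ge (M + ∑ j, ‖a j‖)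
  refine ⟨R, ?_⟩
  filter_upwards [eventually_norm_one_sub_exp_ratio_le hM0] with s hs r hr
  have hfac : ∀ j, ‖(1 - cexp (-s)) * (1 - cexp (-(s * (r + a j))))⁻¹ * z⁻¹‖ ≤ ε := by
    intro j
    have hre : M ≤ ((r : ℂ) + a j).re := by
      have h1 : ‖a j‖ ≤ ∑ j, ‖a j‖ :=
        Finset.single_le_sum (f := fun j => ‖a j‖) (fun _ _ => norm_nonneg _) (Finset.mem_univ j)
      have h2 := (abs_le.mp (Complex.abs_re_le_norm (a j))).1
      have h3 : (R : ℝ) ≤ r := by exact_mod_cast hr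
      simp only [add_re, natCast_re]
      linarith
    rw [norm_mul, norm_inv]
    calc _ ≤ 2 / M * ‖z‖⁻¹ := by gcongr; exact hs _ hre
      _ = ε := by rw [hM]; field_simp
  rw [norm_mul, norm_prod]
  calc ‖Q‖ * ∏ j, ‖(1 - cexp (-s)) * (1 - cexp (-(s * (r + a j))))⁻¹ * z⁻¹‖
      ≤ ‖Q‖ * ∏ _j : Fin (N + 1), ε := by
        gcongr with j
        exact hfac j
    _ = ‖Q‖ * (ε ^ N * ε) := by rw [Finset.prod_const, Finset.card_fin, pow_succ]
    _ ≤ ‖Q‖ * (1 * ε) := by gcongr; exact pow_le_one₀ hε0.le hε1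
    _ ≤ 1 / 2 := by
      rw [hε, one_mul, mul_one_div, div_le_div_iff₀ (by positivity) (by norm_num)]
      linarith

/-- Confluence of the (specialization at `P = Λ_i` of the) small equivariant K-theoretical
J-function of `ℙ^N` to the (specialization at `H = λ_i` of the) small equivariant
cohomological J-function: with `q = q₀^t` and `q^w := exp(w·t·ln q₀)`, the rescaled and
gauge-transformed K-theoretic series converges absolutely for small `t > 0` and tends,
as `t → 0⁺`, to the cohomological series (whose terms are absolutely summable as well,
the limit series being entire in `Q`). -/
theorem stmt12 (N : ℕ) (q₀ : ℝ) (hq0 : 0 < q₀) (hq1 : q₀ < 1)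
    (z : ℂ) (hz : z ≠ 0) (lam : Fin (N + 1) → ℂ) (i : Fin (N + 1)) (Q : ℂ)
    (ha : ∀ j, ∀ r : ℕ, 1 ≤ r → lam i - lam j + r * z ≠ 0)
    (hb : ∀ t ∈ Set.Ioc (0 : ℝ) 1, ∀ j, ∀ r : ℕ, 1 ≤ r →
      1 - Complex.exp (((r : ℂ) + (lam i - lam j) / z) * ((t * Real.log q₀ : ℝ) : ℂ)) ≠ 0)
    (hc : Q ∈ Complex.slitPlane)
    (hθ : ∀ t ∈ Set.Ioc (0 : ℝ) 1, theta ((q₀ ^ t : ℝ) : ℂ) Q ≠ 0) :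
    (∀ᶠ t : ℝ in nhdsWithin 0 (Set.Ioi 0),
      Summable fun d : ℕ =>
        ‖Q ^ d * (1 - ((q₀ ^ t : ℝ) : ℂ)) ^ (d * (N + 1)) * (z ^ (d * (N + 1)))⁻¹ *
          ∏ j : Fin (N + 1), ∏ r ∈ Finset.Icc 1 d,
            (1 - Complex.exp (((r : ℂ) + (lam i - lam j) / z) *
              ((t * Real.log q₀ : ℝ) : ℂ)))⁻¹‖) ∧
    (Summable fun d : ℕ =>
      ‖Q ^ d * ∏ r ∈ Finset.Icc 1 d, ∏ j : Fin (N + 1), (lam i - lam j + r * z)⁻¹‖) ∧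
    Tendsto (fun t : ℝ =>
        Complex.exp (lam i / z * ((t * Real.log q₀ : ℝ) : ℂ) * ellq ((q₀ ^ t : ℝ) : ℂ) Q) *
          ∑' d : ℕ,
            Q ^ d * (1 - ((q₀ ^ t : ℝ) : ℂ)) ^ (d * (N + 1)) * (z ^ (d * (N + 1)))⁻¹ *
              ∏ j : Fin (N + 1), ∏ r ∈ Finset.Icc 1 d,
                (1 - Complex.exp (((r : ℂ) + (lam i - lam j) / z) *
                  ((t * Real.log q₀ : ℝ) : ℂ)))⁻¹)
      (nhdsWithin (0 : ℝ) (Set.Ioi 0))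
      (𝓝 (Complex.exp (lam i / z * Complex.log Q) *
        ∑' d : ℕ,
          Q ^ d * ∏ r ∈ Finset.Icc 1 d, ∏ j : Fin (N + 1), (lam i - lam j + r * z)⁻¹)) := by
  have hL : Real.log q₀ < 0 := Real.log_neg hq0 hq1
  set φ : ℝ → ℝ := fun t => -(t * Real.log q₀) with hφ
  have hφt : Tendsto φ (𝓝[>] 0) (𝓝[>] 0) := by
    refine tendsto_nhdsWithin_iff.mpr ⟨?_, ?_⟩
    · have : Continuous φ := by fun_prop
      simpa [hφ] using (this.tendsto 0).mono_left nhdsWithin_le_nhds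
    · filter_upwards [self_mem_nhdsWithin] with t ht
      exact neg_pos.mpr (mul_neg_of_pos_of_neg ht hL)
  have hq : ∀ t : ℝ, ((q₀ ^ t : ℝ) : ℂ) = cexp (-(φ t : ℂ)) := by
    intro t
    rw [Real.rpow_def_of_pos hq0, ofReal_exp]
    congr 1
    simp only [hφ]
    push_cast
    ring
  have hlog : ∀ t : ℝ, ((t * Real.log q₀ : ℝ) : ℂ) = -(φ t : ℂ) := by
    intro t
    simp [hφ]
  set a : Fin (N + 1) → ℂ := fun j => (lam i - lam j) / z with hadef
  have haz : ∀ j, a j * z = lam i - lam j := fun j => div_mul_cancel₀ _ hz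
  have hane : ∀ r : ℕ, 1 ≤ r → ∀ j, (r : ℂ) + a j ≠ 0 := by
    intro r hr j h
    apply ha j r hr
    rw [← haz, ← add_mul, add_comm, h, zero_mul]
  obtain ⟨R, hR⟩ := eventually_norm_factor_le hz Q a
  obtain ⟨h1, h2, h3⟩ := tendsto_tsum_prod_Icc (fun r hr => tendsto_factor z Q a r (hane r hr)) hR
  have hterm : ∀ (t : ℝ) (d : ℕ),
      Q ^ d * (1 - ((q₀ ^ t : ℝ) : ℂ)) ^ (d * (N + 1)) * (z ^ (d * (N + 1)))⁻¹ *
          ∏ j : Fin (N + 1), ∏ r ∈ Finset.Icc 1 d,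
            (1 - Complex.exp (((r : ℂ) + (lam i - lam j) / z) *
              ((t * Real.log q₀ : ℝ) : ℂ)))⁻¹ =
        ∏ r ∈ Finset.Icc 1 d,
          (Q * ∏ j, ((1 - cexp (-(φ t : ℂ))) * (1 - cexp (-(φ t * (r + a j))))⁻¹ * z⁻¹)) := by
    intro t d
    have he : ∀ (r : ℕ) (j : Fin (N + 1)),
        ((r : ℂ) + (lam i - lam j) / z) * ((t * Real.log q₀ : ℝ) : ℂ) =
          -(φ t * (r + a j)) := by
      intro r j
      rw [hlog]
      ring
    simp only [he]
    rw [hq, Finset.prod_comm]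
    simp only [Finset.prod_mul_distrib, Finset.prod_const, Finset.card_fin, Nat.card_Icc,
      Nat.add_sub_cancel, ← pow_mul, inv_pow]
    rw [mul_comm (N + 1) d]
    ring
  have hlim : ∀ d : ℕ,
      Q ^ d * ∏ r ∈ Finset.Icc 1 d, ∏ j : Fin (N + 1), (lam i - lam j + r * z)⁻¹ =
        ∏ r ∈ Finset.Icc 1 d, (Q * ∏ j, (a j * z + r * z)⁻¹) := by
    intro d
    simp only [haz, Finset.prod_mul_distrib, Finset.prod_const, Nat.card_Icc, Nat.add_sub_cancel]
  simp only [hterm, hlim]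
  refine ⟨hφt.eventually h1, h2, Tendsto.mul ?_ (h3.comp hφt)⟩
  have h4 := (((tendsto_neg_mul_ellq_exp hc).comp hφt).const_mul (lam i / z)).cexp
  refine h4.congr fun t => ?_
  rw [hq, hlog, Function.comp_apply, mul_assoc]
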